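/- Let Ω be a differential 2-form of rank 4 on a smooth 4-dimensional manifold M such that ω_Ω ∧ dω_Ω vanishes nowhere. Then Ω(Z_Ω, T_Ω) = 0 (equivalently ω_Ω(T_Ω) = φ_Ω(Z_Ω) = 0), and: (x) φ_Ω ∧ ω_Ω = i_{T_Ω} dΩ; (xi) L_{T_Ω}Ω = dφ_Ω + φ_Ω∧ω_Ω; (xii) i_{[T_Ω,Z_Ω]}Ω = I(Ω)·ω_Ω − L_{Z_Ω}φ_Ω; (xiii) (i_{[T_Ω,Z_Ω]}Ω) ∧ Ω = (dφ_Ω − I(Ω)·Ω) ∧ ω_Ω; (xiv) ω_Ω([T_Ω, Z_Ω]) = 0. -/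

import Mathlib

/-!  Coordinate formalization of differential forms in four variables,
     following "The equivalence problem of differential 2-forms in 4 variables". -/

open Real Filter

/-- Points of `ℝ⁴`; the coordinates `x¹, x², x³, x⁴` of the paper are `x 0, x 1, x 2, x 3`. -/
abbrev Pt := Fin 4 → ℝ

/-- Partial derivative `∂f/∂xⁱ`. -/
noncomputable def pd (i : Fin 4) (f : Pt → ℝ) (x : Pt) : ℝ :=
  fderiv ℝ f x (Pi.single i 1)

/-- Second partial derivative `∂²f/∂xⁱ∂xʲ`. -/
noncomputable def pd2 (i j : Fin 4) (f : Pt → ℝ) (x : Pt) : ℝ :=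
  pd i (fun y => pd j f y) x

/-- Differential forms of degree 0,1,2,3,4 on `ℝ⁴`, given by their (skew-symmetric)
    coordinate components, and vector fields. -/
abbrev Form0 := Pt → ℝ
abbrev Form1 := Pt → Fin 4 → ℝ
abbrev Form2 := Pt → Fin 4 → Fin 4 → ℝ
abbrev Form3 := Pt → Fin 4 → Fin 4 → Fin 4 → ℝ
abbrev Form4 := Pt → Fin 4 → Fin 4 → Fin 4 → Fin 4 → ℝ
abbrev Vec := Pt → Fin 4 → ℝ

/-- A 2-form has skew-symmetric components. -/
def Alt2 (B : Form2) : Prop := ∀ x i j, B x i j = - B x j i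

/-- Exterior derivative of a function. -/
noncomputable def d0 (f : Form0) : Form1 := fun x i => pd i f x

/-- Exterior derivative of a 1-form. -/
noncomputable def d1 (ω : Form1) : Form2 := fun x i j =>
  pd i (fun y => ω y j) x - pd j (fun y => ω y i) x

/-- Exterior derivative of a 2-form. -/
noncomputable def d2 (B : Form2) : Form3 := fun x i j k =>
  pd i (fun y => B y j k) x - pd j (fun y => B y i k) x + pd k (fun y => B y i j) x

/-- Wedge product of two 1-forms. -/
def w11 (ω η : Form1) : Form2 := fun x i j => ω x i * η x j - ω x j * η x i

/-- Wedge product of a 1-form and a 2-form. -/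
def w12 (ω : Form1) (B : Form2) : Form3 := fun x i j k =>
  ω x i * B x j k - ω x j * B x i k + ω x k * B x i j

/-- Wedge product of a 1-form and a 3-form. -/
def w13 (ω : Form1) (C : Form3) : Form4 := fun x i j k l =>
  ω x i * C x j k l - ω x j * C x i k l + ω x k * C x i j l - ω x l * C x i j k

/-- Wedge product of two 2-forms. -/
def w22 (A B : Form2) : Form4 := fun x i j k l =>
  A x i j * B x k l - A x i k * B x j l + A x i l * B x j k
    + A x j k * B x i l - A x j l * B x i k + A x k l * B x i j

/-- A 2-form is of rank 4 when `Ω ∧ Ω` vanishes nowhere. -/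
def Rank4 (B : Form2) : Prop := ∀ x, w22 B B x ≠ 0

/-- Interior products `i_X`. -/
def i1 (X : Vec) (ω : Form1) : Form0 := fun x => ∑ i, X x i * ω x i
def i2 (X : Vec) (B : Form2) : Form1 := fun x j => ∑ i, X x i * B x i j
def i3 (X : Vec) (C : Form3) : Form2 := fun x j k => ∑ i, X x i * C x i j k
def i4 (X : Vec) (D : Form4) : Form3 := fun x j k l => ∑ i, X x i * D x i j k l

/-- Evaluation `B(X,Y)` of a 2-form on two vector fields. -/
def ev2 (B : Form2) (X Y : Vec) : Form0 := fun x => ∑ i, ∑ j, X x i * Y x j * B x i j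

/-- Evaluation `D(X,Y,Z,W)` of a 4-form on four vector fields. -/
def ev4 (D : Form4) (X Y Z W : Vec) : Form0 := fun x =>
  ∑ i, ∑ j, ∑ k, ∑ l, X x i * Y x j * Z x k * W x l * D x i j k l

/-- Lie derivative of a 1-form (Cartan's magic formula). -/
noncomputable def lie1 (X : Vec) (ω : Form1) : Form1 := fun x i =>
  d0 (i1 X ω) x i + i2 X (d1 ω) x i

/-- Lie derivative of a 2-form (Cartan's magic formula). -/
noncomputable def lie2 (X : Vec) (B : Form2) : Form2 := fun x i j =>
  d1 (i2 X B) x i j + i3 X (d2 B) x i j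

/-- Lie bracket of two vector fields. -/
noncomputable def bracket (X Y : Vec) : Vec := fun x i =>
  ∑ j, (X x j * pd j (fun y => Y y i) x - Y x j * pd j (fun y => X y i) x)

/-- Derivative `X(f)` of a function along a vector field. -/
noncomputable def dirDeriv (X : Vec) (f : Form0) : Form0 := fun x => ∑ j, X x j * pd j f x

/-- Pullback of a 1-form under a smooth map. -/
noncomputable def pull1 (φ : Pt → Pt) (ω : Form1) : Form1 := fun x i =>
  ∑ a, ω (φ x) a * pd i (fun y => φ y a) x

/-- Pullback of a 2-form under a smooth map. -/
noncomputable def pull2 (φ : Pt → Pt) (B : Form2) : Form2 := fun x i j =>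
  ∑ a, ∑ b, B (φ x) a b * pd i (fun y => φ y a) x * pd j (fun y => φ y b) x

/-- A pair of mutually inverse smooth maps: a diffeomorphism of `ℝ⁴` (with inverse). -/
def IsDiffeo (φ ψ : Pt → Pt) : Prop :=
  ContDiff ℝ (⊤ : ℕ∞) φ ∧ ContDiff ℝ (⊤ : ℕ∞) ψ ∧ (∀ x, ψ (φ x) = x) ∧ (∀ x, φ (ψ x) = x)

/-- The covector with components `c` as a linear functional on the tangent space `ℝ⁴`. -/
noncomputable def covec (c : Fin 4 → ℝ) : Pt →ₗ[ℝ] ℝ :=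
  ∑ i, c i • (LinearMap.proj i : Pt →ₗ[ℝ] ℝ)

/-- The class of a 1-form `ω` at `x`: the codimension of the space of tangent vectors `v`
    with `i_v ω = 0` and `i_v (dω) = 0`. -/
noncomputable def classAt (ω : Form1) (x : Pt) : ℕ :=
  4 - Module.finrank ℝ
    ↥(LinearMap.ker (covec (ω x)) ⊓ ⨅ j, LinearMap.ker (covec (fun i => d1 ω x i j)))

/-- Components of the constant 2-form `dxᵃ ∧ dxᵇ`. -/
def dxw (a b : Fin 4) : Fin 4 → Fin 4 → ℝ := fun i j =>
  (if i = a ∧ j = b then (1:ℝ) else 0) - (if i = b ∧ j = a then (1:ℝ) else 0)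

/-- A germ of 2-form (with associated 1-form `ω = ω_Ω`) is of type `t` at `x₀`:
    `ω` is nonsingular at `x₀` and of constant class `t` near `x₀`. -/
def IsTypeAt (ω : Form1) (t : ℕ) (x₀ : Pt) : Prop :=
  ω x₀ ≠ 0 ∧ ∀ᶠ x in nhds x₀, classAt ω x = t

/-- Smooth functions. -/
def Sm (f : Pt → ℝ) : Prop := ContDiff ℝ (⊤ : ℕ∞) f

lemma Sm.diff {f : Pt → ℝ} (hf : Sm f) (x : Pt) : DifferentiableAt ℝ f x :=
  (ContDiff.differentiable hf (by simp)) x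

lemma Sm.pd {f : Pt → ℝ} (hf : Sm f) (i : Fin 4) : Sm (fun y => pd i f y) := by
  unfold Sm _root_.pd
  have h : ContDiff ℝ (⊤ : ℕ∞) (fderiv ℝ f) := ContDiff.fderiv_right hf (by simp)
  exact h.clm_apply contDiff_const

lemma pd_comm {f : Pt → ℝ} (hf : Sm f) (i j : Fin 4) (x : Pt) :
    pd i (fun y => pd j f y) x = pd j (fun y => pd i f y) x := by
  have h : ContDiff ℝ (⊤ : ℕ∞) (fderiv ℝ f) := ContDiff.fderiv_right hf (by simp)
  have hd : DifferentiableAt ℝ (fderiv ℝ f) x := (h.differentiable (by simp)) x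
  have hs : IsSymmSndFDerivAt ℝ f x :=
    (ContDiff.contDiffAt hf).isSymmSndFDerivAt (by
      rw [minSmoothness_of_isRCLikeNormedField]
      exact WithTop.coe_le_coe.mpr (le_top : (2 : ℕ∞) ≤ ⊤))
  have key : ∀ a b : Fin 4, pd a (fun y => pd b f y) x
      = fderiv ℝ (fderiv ℝ f) x (Pi.single a 1) (Pi.single b 1) := by
    intro a b
    unfold pd
    rw [fderiv_clm_apply hd (differentiableAt_const _)]
    simp
  rw [key, key]
  exact hs _ _

lemma pd_add {f g : Pt → ℝ} (hf : Sm f) (hg : Sm g) (i : Fin 4) (x : Pt) :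
    pd i (fun y => f y + g y) x = pd i f x + pd i g x := by
  unfold pd
  rw [fderiv_fun_add (hf.diff x) (hg.diff x)]; rfl

lemma pd_sub {f g : Pt → ℝ} (hf : Sm f) (hg : Sm g) (i : Fin 4) (x : Pt) :
    pd i (fun y => f y - g y) x = pd i f x - pd i g x := by
  unfold pd
  rw [fderiv_fun_sub (hf.diff x) (hg.diff x)]; rfl

lemma pd_mul {f g : Pt → ℝ} (hf : Sm f) (hg : Sm g) (i : Fin 4) (x : Pt) :
    pd i (fun y => f y * g y) x = pd i f x * g x + f x * pd i g x := by
  unfold pd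
  rw [fderiv_fun_mul (hf.diff x) (hg.diff x)]
  simp; ring

lemma Sm.add {f g : Pt → ℝ} (hf : Sm f) (hg : Sm g) : Sm (fun y => f y + g y) :=
  ContDiff.add hf hg
lemma Sm.sub {f g : Pt → ℝ} (hf : Sm f) (hg : Sm g) : Sm (fun y => f y - g y) :=
  ContDiff.sub hf hg
lemma Sm.mul {f g : Pt → ℝ} (hf : Sm f) (hg : Sm g) : Sm (fun y => f y * g y) :=
  ContDiff.mul hf hg

lemma pd_dot {X α : Pt → Fin 4 → ℝ} (hX : ∀ i, Sm (fun y => X y i))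
    (hα : ∀ i, Sm (fun y => α y i)) (i : Fin 4) (x : Pt) :
    pd i (fun y => ∑ k, X y k * α y k) x
      = ∑ k, (pd i (fun y => X y k) x * α x k + X x k * pd i (fun y => α y k) x) := by
  simp only [Fin.sum_univ_four]
  have h := fun k => (hX k).mul (hα k)
  rw [pd_add (((h 0).add (h 1)).add (h 2)) (h 3), pd_add ((h 0).add (h 1)) (h 2),
    pd_add (h 0) (h 1)]
  simp only [pd_mul (hX _) (hα _)]

/-- Exterior derivative of a 3-form. -/
noncomputable def d3 (C : Form3) : Form4 := fun x i j k l =>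
  pd i (fun y => C y j k l) x - pd j (fun y => C y i k l) x
    + pd k (fun y => C y i j l) x - pd l (fun y => C y i j k) x

lemma d3_w12 {ω : Form1} {B : Form2} (hω : ∀ i, Sm (fun y => ω y i))
    (hB : ∀ i j, Sm (fun y => B y i j)) (x : Pt) (i j k l : Fin 4) :
    d3 (w12 ω B) x i j k l = w22 (d1 ω) B x i j k l - w13 ω (d2 B) x i j k l := by
  have key : ∀ a b c e : Fin 4, pd a (fun y => w12 ω B y b c e) x
      = pd a (fun y => ω y b) x * B x c e + ω x b * pd a (fun y => B y c e) x
        - (pd a (fun y => ω y c) x * B x b e + ω x c * pd a (fun y => B y b e) x)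
        + (pd a (fun y => ω y e) x * B x b c + ω x e * pd a (fun y => B y b c) x) := by
    intro a b c e
    unfold w12
    rw [pd_add (((hω b).mul (hB c e)).sub ((hω c).mul (hB b e))) ((hω e).mul (hB b c)),
      pd_sub ((hω b).mul (hB c e)) ((hω c).mul (hB b e)), pd_mul (hω b) (hB c e),
      pd_mul (hω c) (hB b e), pd_mul (hω e) (hB b c)]
  unfold d3
  rw [key, key, key, key]
  unfold w22 d1 w13 d2
  ring

lemma d3_d2 {B : Form2} (hB : ∀ i j, Sm (fun y => B y i j)) (x : Pt) (i j k l : Fin 4) :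
    d3 (d2 B) x i j k l = 0 := by
  have key : ∀ a b c e : Fin 4, pd a (fun y => d2 B y b c e) x
      = pd a (fun y => pd b (fun z => B z c e) y) x - pd a (fun y => pd c (fun z => B z b e) y) x
        + pd a (fun y => pd e (fun z => B z b c) y) x := by
    intro a b c e
    unfold d2
    rw [pd_add (((hB c e).pd b).sub ((hB b e).pd c)) ((hB b c).pd e),
      pd_sub ((hB c e).pd b) ((hB b e).pd c)]
  unfold d3
  rw [key, key, key, key, pd_comm (hB k l) i j, pd_comm (hB j l) i k, pd_comm (hB j k) i l,
    pd_comm (hB i l) j k, pd_comm (hB i k) j l, pd_comm (hB i j) k l]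
  ring

lemma d2_d1 {ω : Form1} (hω : ∀ i, Sm (fun y => ω y i)) (x : Pt) (i j k : Fin 4) :
    d2 (d1 ω) x i j k = 0 := by
  unfold d2 d1
  rw [pd_sub ((hω k).pd j) ((hω j).pd k), pd_sub ((hω k).pd i) ((hω i).pd k),
    pd_sub ((hω j).pd i) ((hω i).pd j), pd_comm (hω k) i j, pd_comm (hω j) i k,
    pd_comm (hω i) j k]
  ring

lemma i4_w22 (X : Vec) (A B : Form2) (x : Pt) (i j k : Fin 4) :
    i4 X (w22 A B) x i j k = w12 (i2 X A) B x i j k + w12 (i2 X B) A x i j k := by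
  simp only [i4, w22, w12, i2, Fin.sum_univ_four]; ring

lemma i3_w12 (X : Vec) (α : Form1) (B : Form2) (x : Pt) (i j : Fin 4) :
    i3 X (w12 α B) x i j = i1 X α x * B x i j - w11 α (i2 X B) x i j := by
  simp only [i3, w11, w12, i1, i2, Fin.sum_univ_four]; ring

lemma alt_diag {B : Form2} (hB : Alt2 B) (x : Pt) (i : Fin 4) : B x i i = 0 := by
  have := hB x i i; linarith

lemma rank4_ne {B : Form2} (hB : Alt2 B) (hr : Rank4 B) (x : Pt) :
    B x 0 1 * B x 2 3 - B x 0 2 * B x 1 3 + B x 0 3 * B x 1 2 ≠ 0 := by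
  intro h
  apply hr x
  have hd := alt_diag hB x
  have e10 := hB x 1 0
  have e20 := hB x 2 0
  have e30 := hB x 3 0
  have e21 := hB x 2 1
  have e31 := hB x 3 1
  have e32 := hB x 3 2
  funext i j k l
  fin_cases i <;> fin_cases j <;> fin_cases k <;> fin_cases l <;>
    simp [w22, hd, e10, e20, e30, e21, e31, e32] <;> linarith

lemma w12_inj {B : Form2} (hB : Alt2 B) (hr : Rank4 B) (α : Form1) (x : Pt)
    (h : ∀ i j k, w12 α B x i j k = 0) (i : Fin 4) : α x i = 0 := by
  have hp := rank4_ne hB hr x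
  have a := h 0 1 2
  have b := h 0 1 3
  have c := h 0 2 3
  have e := h 1 2 3
  simp only [w12] at a b c e
  have : α x i * (B x 0 1 * B x 2 3 - B x 0 2 * B x 1 3 + B x 0 3 * B x 1 2) = 0 := by
    fin_cases i <;> simp only [Fin.zero_eta, Fin.mk_one, Fin.reduceFinMk]
    · linear_combination B x 0 1 * c - B x 0 2 * b + B x 0 3 * a
    · linear_combination B x 0 1 * e - B x 1 2 * b + B x 1 3 * a
    · linear_combination B x 0 2 * e - B x 1 2 * c + B x 2 3 * a
    · linear_combination B x 0 3 * e - B x 1 3 * c + B x 2 3 * b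
  exact (mul_eq_zero.mp this).resolve_right hp

lemma w13_w12_i2 {B : Form2} (hB : Alt2 B) (α : Form1) (X : Vec) (x : Pt) :
    w13 α (w12 (i2 X B) B) x 0 1 2 3 = i1 X α x *
      (B x 0 1 * B x 2 3 - B x 0 2 * B x 1 3 + B x 0 3 * B x 1 2) := by
  have hd := alt_diag hB x
  simp only [w13, w12, i2, i1, Fin.sum_univ_four, hd, hB x 1 0, hB x 2 0, hB x 3 0, hB x 2 1,
    hB x 3 1, hB x 3 2]
  ring

lemma i1_i2_self {B : Form2} (hB : Alt2 B) (X : Vec) (x : Pt) : i1 X (i2 X B) x = 0 := by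
  have hd := alt_diag hB x
  simp only [i2, i1, Fin.sum_univ_four, hd, hB x 1 0, hB x 2 0, hB x 3 0, hB x 2 1,
    hB x 3 1, hB x 3 2]
  ring

lemma i1_i2_swap {B : Form2} (hB : Alt2 B) (X Y : Vec) (x : Pt) :
    i1 X (i2 Y B) x = - i1 Y (i2 X B) x := by
  have hd := alt_diag hB x
  simp only [i2, i1, Fin.sum_univ_four, hd, hB x 1 0, hB x 2 0, hB x 3 0, hB x 2 1,
    hB x 3 1, hB x 3 2]
  ring

lemma alt_d1 (ω : Form1) : Alt2 (d1 ω) := by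
  intro x i j; unfold d1; ring

/-- Algebraic core of the computation of `i_{[T,Z]}Ω`. -/
lemma bracket_core {Ω : Form2} (hΩ : ∀ i j, Sm (fun y => Ω y i j)) (hΩa : Alt2 Ω)
    {T Z : Vec} (hTs : ∀ i, Sm (fun y => T y i)) (hZs : ∀ i, Sm (fun y => Z y i))
    {ω θ : Form1} (hω : ∀ i, Sm (fun y => ω y i)) (hθ : ∀ i, Sm (fun y => θ y i))
    (hZ : i2 Z Ω = ω) (hT : i2 T Ω = θ) (hTω : ∀ x, i1 T ω x = 0) (hZθ : ∀ x, i1 Z θ x = 0)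
    (x : Pt) (i : Fin 4) :
    i2 (bracket T Z) Ω x i = i2 T (d1 ω) x i - i2 Z (d1 θ) x i - i2 Z (i3 T (d2 Ω)) x i := by
  have eω : ∀ a b, pd a (fun y => ω y b) x = ∑ k, (pd a (fun y => Z y k) x * Ω x k b
      + Z x k * pd a (fun y => Ω y k b) x) := by
    intro a b
    rw [← hZ]; exact pd_dot (α := fun y k => Ω y k b) hZs (fun k => hΩ k b) a x
  have eθ : ∀ a b, pd a (fun y => θ y b) x = ∑ k, (pd a (fun y => T y k) x * Ω x k b
      + T x k * pd a (fun y => Ω y k b) x) := by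
    intro a b
    rw [← hT]; exact pd_dot (α := fun y k => Ω y k b) hTs (fun k => hΩ k b) a x
  have zθ : ∑ k, (pd i (fun y => Z y k) x * θ x k + Z x k * pd i (fun y => θ y k) x) = 0 := by
    rw [← pd_dot hZs hθ]
    have : (fun y => ∑ k, Z y k * θ y k) = fun _ => (0:ℝ) := funext hZθ
    rw [this]; simp [pd]
  have vθ : ∀ k, θ x k = -∑ j, T x j * Ω x k j := by
    intro k
    rw [← hT]; simp only [i2, Fin.sum_univ_four]
    rw [hΩa x k 0, hΩa x k 1, hΩa x k 2, hΩa x k 3]; ring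
  have aΩ : ∀ a b c, pd a (fun y => Ω y b c) x = - pd a (fun y => Ω y c b) x := by
    intro a b c
    have : (fun y => Ω y b c) = fun y => - Ω y c b := funext fun y => hΩa y b c
    rw [this]; unfold pd; rw [fderiv_fun_neg]; rfl
  simp only [Fin.sum_univ_four] at eω eθ zθ vθ
  simp only [i2, i3, d1, d2, bracket, Fin.sum_univ_four]
  have S : ∀ k, pd i (fun y => Z y k) x * (θ x k + (T x 0 * Ω x k 0 + T x 1 * Ω x k 1
      + T x 2 * Ω x k 2 + T x 3 * Ω x k 3)) = 0 := by
    intro k; rw [vθ k]; ring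
  have A := fun j k => aΩ i j k
  linear_combination - T x 0 * eω 0 i - T x 1 * eω 1 i - T x 2 * eω 2 i - T x 3 * eω 3 i
    + Z x 0 * eθ 0 i + Z x 1 * eθ 1 i + Z x 2 * eθ 2 i + Z x 3 * eθ 3 i
    + T x 0 * eω i 0 + T x 1 * eω i 1 + T x 2 * eω i 2 + T x 3 * eω i 3
    - zθ + S 0 + S 1 + S 2 + S 3
    + T x 0 * Z x 0 * A 0 0 + T x 0 * Z x 1 * A 0 1 + T x 0 * Z x 2 * A 0 2 + T x 0 * Z x 3 * A 0 3
    + T x 1 * Z x 0 * A 1 0 + T x 1 * Z x 1 * A 1 1 + T x 1 * Z x 2 * A 1 2 + T x 1 * Z x 3 * A 1 3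
    + T x 2 * Z x 0 * A 2 0 + T x 2 * Z x 1 * A 2 1 + T x 2 * Z x 2 * A 2 2 + T x 2 * Z x 3 * A 2 3
    + T x 3 * Z x 0 * A 3 0 + T x 3 * Z x 1 * A 3 1 + T x 3 * Z x 2 * A 3 2 + T x 3 * Z x 3 * A 3 3

/-- Proposition `ZandT`, items (x)–(xiv). If `ω_Ω ∧ dω_Ω` vanishes
nowhere then `Ω(Z_Ω,T_Ω) = 0` (equivalently `ω_Ω(T_Ω) = φ_Ω(Z_Ω) = 0`) and:
(x) `φ_Ω ∧ ω_Ω = i_{T_Ω}dΩ`; (xi) `L_{T_Ω}Ω = dφ_Ω + φ_Ω∧ω_Ω`;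
(xii) `i_{[T_Ω,Z_Ω]}Ω = I(Ω)·ω_Ω − L_{Z_Ω}φ_Ω`;
(xiii) `(i_{[T_Ω,Z_Ω]}Ω) ∧ Ω = (dφ_Ω − I(Ω)·Ω) ∧ ω_Ω`; (xiv) `ω_Ω([T_Ω,Z_Ω]) = 0`. -/
theorem ZandT_contact (Ω : Form2) (hΩs : ContDiff ℝ (⊤ : ℕ∞) Ω) (hΩa : Alt2 Ω)
    (hΩr : Rank4 Ω)
    (ω : Form1) (hωs : ContDiff ℝ (⊤ : ℕ∞) ω) (hω : ∀ x, w12 ω Ω x = d2 Ω x)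
    (θ : Form1) (hθs : ContDiff ℝ (⊤ : ℕ∞) θ) (hθ : ∀ x, w12 θ Ω x = w12 ω (d1 ω) x)
    (Z : Vec) (hZs : ContDiff ℝ (⊤ : ℕ∞) Z) (hZ : ∀ x, i2 Z Ω x = ω x)
    (T : Vec) (hTs : ContDiff ℝ (⊤ : ℕ∞) T) (hT : ∀ x, i2 T Ω x = θ x)
    (I : Form0) (hI : ∀ x i j k l, I x * w22 Ω Ω x i j k l = w22 (d1 ω) (d1 ω) x i j k l)
    (hnv : ∀ x, w12 ω (d1 ω) x ≠ 0) :
    (∀ x, ev2 Ω Z T x = 0) ∧ (∀ x, i1 T ω x = 0) ∧ (∀ x, i1 Z θ x = 0) ∧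
    (∀ x i j, w11 θ ω x i j = i3 T (d2 Ω) x i j) ∧
    (∀ x i j, lie2 T Ω x i j = d1 θ x i j + w11 θ ω x i j) ∧
    (∀ x i, i2 (bracket T Z) Ω x i = I x * ω x i - lie1 Z θ x i) ∧
    (∀ x i j k, w12 (i2 (bracket T Z) Ω) Ω x i j k
      = w12 ω (fun y a b => d1 θ y a b - I y * Ω y a b) x i j k) ∧
    (∀ x, i1 (bracket T Z) ω x = 0) := by
  have sΩ : ∀ i j, Sm (fun y => Ω y i j) := fun i j =>
    contDiff_pi.mp (contDiff_pi.mp hΩs i) j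
  have sω : ∀ i, Sm (fun y => ω y i) := fun i => contDiff_pi.mp hωs i
  have sθ : ∀ i, Sm (fun y => θ y i) := fun i => contDiff_pi.mp hθs i
  have sZ : ∀ i, Sm (fun y => Z y i) := fun i => contDiff_pi.mp hZs i
  have sT : ∀ i, Sm (fun y => T y i) := fun i => contDiff_pi.mp hTs i
  have sdω : ∀ i j, Sm (fun y => d1 ω y i j) := fun i j => ((sω j).pd i).sub ((sω i).pd j)
  have hω' : w12 ω Ω = d2 Ω := funext hω
  have hθ' : w12 θ Ω = w12 ω (d1 ω) := funext hθ
  have hZ' : i2 Z Ω = ω := funext hZ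
  have hT' : i2 T Ω = θ := funext hT
  -- `dω ∧ Ω = 0`
  have h1 : ∀ x i j k l, w22 (d1 ω) Ω x i j k l = 0 := by
    intro x i j k l
    have a := d3_w12 sω sΩ x i j k l
    rw [hω', d3_d2 sΩ, ← hω'] at a
    have b : w13 ω (w12 ω Ω) x i j k l = 0 := by simp only [w13, w12]; ring
    linarith
  -- `ω(T) = 0`, `θ(Z) = 0`
  have h2 : ∀ x, i1 T ω x = 0 := by
    intro x
    have a := w13_w12_i2 hΩa ω T x
    rw [hT', hθ'] at a
    have b : w13 ω (w12 ω (d1 ω)) x 0 1 2 3 = 0 := by simp only [w13, w12]; ring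
    rw [b] at a
    exact (mul_eq_zero.mp a.symm).resolve_right (rank4_ne hΩa hΩr x)
  have h2' : ∀ x, i1 Z θ x = 0 := by
    intro x
    rw [← hT', i1_i2_swap hΩa, hZ', h2, neg_zero]
  have hZω : ∀ x, i1 Z ω x = 0 := by
    intro x
    rw [← hZ', i1_i2_self hΩa]
  -- `i_Z dω = -θ`
  have h3 : ∀ x i, i2 Z (d1 ω) x i = - θ x i := by
    intro x i
    have := w12_inj hΩa hΩr (fun y a => i2 Z (d1 ω) y a + θ y a) x (by
      intro i j k
      have a := i4_w22 Z (d1 ω) Ω x i j k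
      have z : i4 Z (w22 (d1 ω) Ω) x i j k = 0 := by simp [i4, h1]
      rw [z, hZ', ← hθ'] at a
      rw [a]; simp only [w12]; ring) i
    linarith
  -- `I ω ∧ Ω = i_Z dω ∧ dω`
  have hIw : ∀ x i j k, I x * w12 ω Ω x i j k = - w12 θ (d1 ω) x i j k := by
    intro x i j k
    have a := i4_w22 Z (d1 ω) (d1 ω) x i j k
    have b := i4_w22 Z Ω Ω x i j k
    have c : I x * i4 Z (w22 Ω Ω) x i j k = i4 Z (w22 (d1 ω) (d1 ω)) x i j k := by
      simp only [i4, ← hI, Finset.mul_sum]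
      exact Finset.sum_congr rfl fun _ _ => by ring
    have e : w12 (i2 Z (d1 ω)) (d1 ω) x i j k = - w12 θ (d1 ω) x i j k := by
      simp only [w12, h3]; ring
    rw [hZ'] at b
    rw [b, a, e] at c
    linarith
  -- `i_T dω = I ω`
  have h4 : ∀ x i, i2 T (d1 ω) x i = I x * ω x i := by
    intro x i
    have := w12_inj hΩa hΩr (fun y a => i2 T (d1 ω) y a - I y * ω y a) x (by
      intro i j k
      have a := i4_w22 T (d1 ω) Ω x i j k
      have z : i4 T (w22 (d1 ω) Ω) x i j k = 0 := by simp [i4, h1]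
      rw [z, hT'] at a
      have b := hIw x i j k
      simp only [w12] at a b ⊢
      linear_combination - a - b) i
    linarith
  -- `dθ ∧ Ω = dω ∧ dω`
  have h5 : ∀ x i j k l, w22 (d1 θ) Ω x i j k l = I x * w22 Ω Ω x i j k l := by
    intro x i j k l
    have a := d3_w12 sθ sΩ x i j k l
    have b := d3_w12 sω sdω x i j k l
    have c : w13 ω (d2 (d1 ω)) x i j k l = 0 := by simp [w13, d2_d1 sω]
    have e : w13 θ (w12 ω Ω) x i j k l = - w13 ω (w12 θ Ω) x i j k l := by
      simp only [w13, w12]; ring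
    have f : w13 ω (w12 ω (d1 ω)) x i j k l = 0 := by simp only [w13, w12]; ring
    rw [← hω', e, hθ', f, b, c] at a
    rw [hI]; linarith
  have hx : ∀ x i j, w11 θ ω x i j = i3 T (d2 Ω) x i j := by
    intro x i j
    rw [← hω', i3_w12, h2, hT']
    simp only [w11]; ring
  have hbr : ∀ x i, i2 (bracket T Z) Ω x i = I x * ω x i - i2 Z (d1 θ) x i := by
    intro x i
    rw [bracket_core sΩ hΩa sT sZ sω sθ hZ' hT' h2 h2', h4]
    have : i2 Z (i3 T (d2 Ω)) x i = i1 Z θ x * ω x i - i1 Z ω x * θ x i := by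
      simp only [i2, ← hx, w11, i1, Fin.sum_univ_four]; ring
    rw [this, h2', hZω]; ring
  refine ⟨?_, h2, h2', hx, ?_, ?_, ?_, ?_⟩
  · intro x
    rw [← h2 x, ← hZ']
    simp only [ev2, i1, i2, Fin.sum_univ_four]; ring
  · intro x i j
    unfold lie2
    rw [hT', hx]
  · intro x i
    rw [hbr]
    have : i1 Z θ = fun _ => (0:ℝ) := funext h2'
    unfold lie1
    rw [this]; simp [d0, pd]
  · intro x i j k
    have a := i4_w22 Z (d1 θ) Ω x i j k
    have b := i4_w22 Z Ω Ω x i j k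
    have c : i4 Z (w22 (d1 θ) Ω) x i j k = I x * i4 Z (w22 Ω Ω) x i j k := by
      simp only [i4, h5, Finset.mul_sum]
      exact Finset.sum_congr rfl fun _ _ => by ring
    rw [a, b, hZ'] at c
    simp only [w12, hbr] at c ⊢
    linear_combination -c
  · intro x
    rw [← hZ', i1_i2_swap hΩa]
    have a := i1_i2_self (alt_d1 θ) Z x
    have b := hZω x
    simp only [i1, hbr, Fin.sum_univ_four] at a b ⊢
    linear_combination a - I x * b
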